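/- Let n ≥ 2 and let k ≥ 2 be an integer. Let v be a global solution to the thin obstacle problem in ℝ^{n+1} with thin obstacle φ(x') := 1 − |x'|^k, such that v(x) → 0 as |x| → ∞. Then the coincidence set on the thin space satisfies {x' ∈ ℝ^n : |x'| ≤ ρ̄(k, n)} ⊆ {x' ∈ ℝ^n : v(x', 0) = 1 − |x'|^k} ⊆ {x' ∈ ℝ^n : |x'| ≤ 1}, where ρ̄(k, n) is the explicit constant defined below; in particular the constant c_{n,k} := 1 − ρ̄(k, n) satisfies c_{n,k} → 0 as k → ∞. -/

import Mathlib

open MeasureTheory Metric Set Filter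

noncomputable section

/-- The point `(x', t)` of `ℝ^{n+1}`, where `x' ∈ ℝ^n`. -/
def thinEmbed (n : ℕ) (x' : EuclideanSpace ℝ (Fin n)) (t : ℝ) :
    EuclideanSpace ℝ (Fin (n + 1)) :=
  (EuclideanSpace.equiv (Fin (n + 1)) ℝ).symm (Fin.snoc (fun i => x' i) t)

/-- Projection of a point of `ℝ^{n+1}` to its first `n` coordinates. -/
def thinProj (n : ℕ) (x : EuclideanSpace ℝ (Fin (n + 1))) : EuclideanSpace ℝ (Fin n) :=
  (EuclideanSpace.equiv (Fin n) ℝ).symm (fun i => x i.castSucc)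

/-- The Laplacian of `f : ℝ^d → ℝ`: the sum of pure second partial derivatives. -/
def lapl (d : ℕ) (f : EuclideanSpace ℝ (Fin d) → ℝ) (x : EuclideanSpace ℝ (Fin d)) : ℝ :=
  ∑ i : Fin d,
    fderiv ℝ (fun y => fderiv ℝ f y (EuclideanSpace.single i 1)) x (EuclideanSpace.single i 1)

/-- `f` is harmonic on a set: twice continuously differentiable with vanishing Laplacian. -/
def IsHarmonicOnSet (d : ℕ) (f : EuclideanSpace ℝ (Fin d) → ℝ)
    (s : Set (EuclideanSpace ℝ (Fin d))) : Prop :=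
  ContDiffOn ℝ 2 f s ∧ ∀ x ∈ s, lapl d f x = 0

/-- Super-mean-value property w.r.t. averages over balls
(encodes `Δf ≤ 0` for continuous `f`). -/
def SuperMeanVal (d : ℕ) (f : EuclideanSpace ℝ (Fin d) → ℝ) : Prop :=
  ∀ (x : EuclideanSpace ℝ (Fin d)) (r : ℝ), 0 < r → (⨍ y in Metric.ball x r, f y) ≤ f x

/-- The contact set `Λ_φ(u) = {(x',0) : u(x',0) = φ(x')}`. -/
def contactSet (n : ℕ) (φ : EuclideanSpace ℝ (Fin n) → ℝ)
    (u : EuclideanSpace ℝ (Fin (n + 1)) → ℝ) : Set (EuclideanSpace ℝ (Fin (n + 1))) :=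
  {x | x (Fin.last n) = 0 ∧ u x = φ (thinProj n x)}

/-- Global solution to the thin obstacle problem in `ℝ^{n+1}` with thin obstacle `φ`:
continuous, even in the last variable, above the obstacle on the thin space,
harmonic outside the contact set, and superharmonic (mean value inequality). -/
def IsGlobalSolution (n : ℕ) (φ : EuclideanSpace ℝ (Fin n) → ℝ)
    (u : EuclideanSpace ℝ (Fin (n + 1)) → ℝ) : Prop :=
  Continuous u ∧
  (∀ x' t, u (thinEmbed n x' t) = u (thinEmbed n x' (-t))) ∧
  (∀ x', φ x' ≤ u (thinEmbed n x' 0)) ∧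
  IsHarmonicOnSet (n + 1) u (contactSet n φ u)ᶜ ∧
  SuperMeanVal (n + 1) u

/-- Evaluation of a real polynomial at a point of `ℝ^d`. -/
def pev {d : ℕ} (q : MvPolynomial (Fin d) ℝ) (x : EuclideanSpace ℝ (Fin d)) : ℝ :=
  MvPolynomial.eval (fun i => x i) q

/-- Polynomial growth (of some order). -/
def HasPolyGrowth (d : ℕ) (u : EuclideanSpace ℝ (Fin d) → ℝ) : Prop :=
  ∃ (m : ℕ) (C : ℝ), ∀ x, |u x| ≤ C * (1 + ‖x‖ ^ m)

/-- Polynomial growth of order exactly `m` (and `m` is the smallest such order). -/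
def PolyGrowthOrder (d : ℕ) (u : EuclideanSpace ℝ (Fin d) → ℝ) (m : ℕ) : Prop :=
  (∃ C : ℝ, ∀ x, |u x| ≤ C * (1 + ‖x‖ ^ m)) ∧
  ∀ m' : ℕ, (∃ C : ℝ, ∀ x, |u x| ≤ C * (1 + ‖x‖ ^ m')) → m ≤ m'

/-- The class `𝒫ᵒ_{n+1}`: polynomials `q` even in the last variable such that
`x_{n+1} q(x)` is harmonic and `closure {q(·,0) < 0}` is compact. -/
def MemPo (n : ℕ) (q : MvPolynomial (Fin (n + 1)) ℝ) : Prop :=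
  (∀ x' t, pev q (thinEmbed n x' t) = pev q (thinEmbed n x' (-t))) ∧
  IsHarmonicOnSet (n + 1) (fun x => x (Fin.last n) * pev q x) Set.univ ∧
  IsCompact (closure {x' : EuclideanSpace ℝ (Fin n) | pev q (thinEmbed n x' 0) < 0})

/-- The class `𝒫ᵉ_{n+1}`: harmonic polynomials `p` even in the last variable such that
`closure {p(·,0) < 0}` is compact. -/
def MemPe (n : ℕ) (p : MvPolynomial (Fin (n + 1)) ℝ) : Prop :=
  (∀ x' t, pev p (thinEmbed n x' t) = pev p (thinEmbed n x' (-t))) ∧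
  IsHarmonicOnSet (n + 1) (pev p) Set.univ ∧
  IsCompact (closure {x' : EuclideanSpace ℝ (Fin n) | pev p (thinEmbed n x' 0) < 0})

/-- `f(x) → 0` as `|x| → ∞`. -/
def VanishAtInfty (d : ℕ) (f : EuclideanSpace ℝ (Fin d) → ℝ) : Prop :=
  ∀ ε > 0, ∃ R : ℝ, ∀ x, R ≤ ‖x‖ → |f x| < ε

/-- The embedding of a subset of `ℝ^n` into the thin space of `ℝ^{n+1}`. -/
def thinSet (n : ℕ) (S : Set (EuclideanSpace ℝ (Fin n))) :
    Set (EuclideanSpace ℝ (Fin (n + 1))) :=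
  (fun x' => thinEmbed n x' 0) '' S

/-- The free boundary `Γ(u)`: the boundary in `ℝ^n` of the positivity set, embedded. -/
def freeBoundary (n : ℕ) (u : EuclideanSpace ℝ (Fin (n + 1)) → ℝ) :
    Set (EuclideanSpace ℝ (Fin (n + 1))) :=
  thinSet n (frontier {x' : EuclideanSpace ℝ (Fin n) | 0 < u (thinEmbed n x' 0)})

/-- Negating the `i`-th coordinate of a point of `ℝ^d`. -/
def negCoordAt (d : ℕ) (i : Fin d) (x : EuclideanSpace ℝ (Fin d)) :
    EuclideanSpace ℝ (Fin d) :=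
  (EuclideanSpace.equiv (Fin d) ℝ).symm (Function.update (fun j => x j) i (-(x i)))

/-- The constant `ρ̄(k, n)`, where `κ = k/(n-1)`. -/
def rhoBar (k n : ℕ) : ℝ :=
  ((k : ℝ) / ((n : ℝ) - 1)) ^ (-(1 : ℝ) / (((n : ℝ) - 1) * ((k : ℝ) / ((n : ℝ) - 1) + 1))) *
    (((k : ℝ) / ((n : ℝ) - 1)) ^
        (-((k : ℝ) / ((n : ℝ) - 1)) / ((k : ℝ) / ((n : ℝ) - 1) + 1)) +
      ((k : ℝ) / ((n : ℝ) - 1)) ^ ((1 : ℝ) / ((k : ℝ) / ((n : ℝ) - 1) + 1))) ^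
      (-(1 : ℝ) / (((n : ℝ) - 1) * ((k : ℝ) / ((n : ℝ) - 1))))

/-- The barrier function `g_{A,t}(r) = A r^{1-n} + t - 1 + r^k`. -/
def gfun (n k : ℕ) (A t r : ℝ) : ℝ :=
  A * r ^ ((1 : ℝ) - (n : ℝ)) + t - 1 + r ^ k

/-- The necessary second-order condition at a local maximum of a function of one variable. -/
lemma nonpos_of_isLocalMax_of_hasDerivAt {g g' : ℝ → ℝ} {x c : ℝ}
    (hg : ∀ᶠ s in nhds x, HasDerivAt g (g' s) s) (hg' : HasDerivAt g' c x)
    (hmax : IsLocalMax g x) : c ≤ 0 := by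
  by_contra! hc
  have hderiv : deriv g =ᶠ[nhds x] g' := hg.mono fun s hs => hs.deriv
  have hsecond : deriv (deriv g) x = c := hderiv.deriv_eq.trans hg'.deriv
  have hmin : IsLocalMin g x :=
    isLocalMin_of_deriv_deriv_pos (hsecond ▸ hc) hmax.deriv_eq_zero
      hg.self_of_nhds.continuousAt
  have hconst : g =ᶠ[nhds x] fun _ => g x := by
    filter_upwards [hmax, hmin] with s h₁ h₂ using le_antisymm h₁ h₂
  have hzero : deriv (deriv g) x = 0 := by
    rw [hconst.deriv.deriv_eq]
    simp
  linarith

/-- The Laplacian is nonpositive at a local maximum. -/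
lemma lapl_nonpos_of_isLocalMax {d : ℕ} {f : EuclideanSpace ℝ (Fin d) → ℝ}
    {x : EuclideanSpace ℝ (Fin d)} (hf : ContDiffAt ℝ 2 f x) (hmax : IsLocalMax f x) :
    lapl d f x ≤ 0 := by
  refine Finset.sum_nonpos fun i _ => ?_
  set e : EuclideanSpace ℝ (Fin d) := EuclideanSpace.single i 1
  have hline (s : ℝ) : HasDerivAt (fun s : ℝ => x + s • e) e s := by
    simpa using ((hasDerivAt_id s).smul_const e).const_add x
  have hcont : Tendsto (fun s : ℝ => x + s • e) (nhds 0) (nhds x) := by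
    simpa using (hline 0).continuousAt.tendsto
  have hdiff : DifferentiableAt ℝ (fun y => fderiv ℝ f y e) x :=
    ((hf.fderiv_right (m := 1) (by norm_num)).clm_apply contDiffAt_const).differentiableAt
      (by norm_num)
  refine nonpos_of_isLocalMax_of_hasDerivAt (g := fun s : ℝ => f (x + s • e))
    (g' := fun s : ℝ => fderiv ℝ f (x + s • e) e) (x := 0) ?_ ?_ ?_
  · filter_upwards [hcont.eventually (hf.eventually (by simp))] with s hs
    exact (hs.differentiableAt (by norm_num)).hasFDerivAt.comp_hasDerivAt s (hline s)
  · have h : HasFDerivAt (fun y => fderiv ℝ f y e) (fderiv ℝ (fun y => fderiv ℝ f y e) x)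
        (x + (0 : ℝ) • e) := by simpa using hdiff.hasFDerivAt
    exact h.comp_hasDerivAt (0 : ℝ) (hline 0)
  · have : ∀ᶠ s : ℝ in nhds 0, f (x + s • e) ≤ f x := hcont.eventually hmax
    simpa [IsLocalMax, IsMaxFilter] using this

lemma lapl_add {d : ℕ} {f g : EuclideanSpace ℝ (Fin d) → ℝ} {x : EuclideanSpace ℝ (Fin d)}
    (hf : ContDiffAt ℝ 2 f x) (hg : ContDiffAt ℝ 2 g x) :
    lapl d (fun y => f y + g y) x = lapl d f x + lapl d g x := by
  unfold lapl
  rw [← Finset.sum_add_distrib]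
  refine Finset.sum_congr rfl fun i _ => ?_
  have hdiff {h : EuclideanSpace ℝ (Fin d) → ℝ} (hh : ContDiffAt ℝ 2 h x) :
      DifferentiableAt ℝ (fun y => fderiv ℝ h y (EuclideanSpace.single i 1)) x :=
    ((hh.fderiv_right (m := 1) (by norm_num)).clm_apply contDiffAt_const).differentiableAt
      (by norm_num)
  have heq : (fun y => fderiv ℝ (fun z => f z + g z) y (EuclideanSpace.single i 1)) =ᶠ[nhds x]
      fun y => fderiv ℝ f y (EuclideanSpace.single i 1) +
        fderiv ℝ g y (EuclideanSpace.single i 1) := by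
    filter_upwards [hf.eventually (by simp), hg.eventually (by simp)] with y hfy hgy
    rw [fderiv_fun_add (hfy.differentiableAt (by norm_num)) (hgy.differentiableAt (by norm_num))]
    rfl
  rw [heq.fderiv_eq, fderiv_fun_add (hdiff hf) (hdiff hg)]
  rfl

lemma lapl_const_mul {d : ℕ} {f : EuclideanSpace ℝ (Fin d) → ℝ} {x : EuclideanSpace ℝ (Fin d)}
    (c : ℝ) : lapl d (fun y => c * f y) x = c * lapl d f x := by
  have h (g : EuclideanSpace ℝ (Fin d) → ℝ) (y e : EuclideanSpace ℝ (Fin d)) :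
      fderiv ℝ (fun z => c * g z) y e = c * fderiv ℝ g y e := by
    rw [show (fun z => c * g z) = c • g from rfl, fderiv_const_smul_field]
    rfl
  simp only [lapl, Finset.mul_sum, h]

lemma lapl_const {d : ℕ} (c : ℝ) (x : EuclideanSpace ℝ (Fin d)) :
    lapl d (fun _ => c) x = 0 := by
  simp [lapl]

lemma hasFDerivAt_norm_sq_rpow {d : ℕ} (p : ℝ) {x : EuclideanSpace ℝ (Fin d)} (hx : x ≠ 0) :
    HasFDerivAt (fun y : EuclideanSpace ℝ (Fin d) => (‖y‖ ^ 2) ^ p)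
      ((p * (‖x‖ ^ 2) ^ (p - 1)) • (2 • innerSL ℝ x)) x :=
  (hasStrictFDerivAt_norm_sq x).hasFDerivAt.rpow_const (Or.inl (by positivity))

lemma contDiffAt_norm_sq_rpow {d : ℕ} (p : ℝ) {x : EuclideanSpace ℝ (Fin d)} (hx : x ≠ 0) :
    ContDiffAt ℝ 2 (fun y : EuclideanSpace ℝ (Fin d) => (‖y‖ ^ 2) ^ p) x :=
  (contDiff_norm_sq ℝ).contDiffAt.rpow_const_of_ne (by positivity)

lemma lapl_norm_sq_rpow {d : ℕ} (p : ℝ) {x : EuclideanSpace ℝ (Fin d)} (hx : x ≠ 0) :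
    lapl d (fun y => (‖y‖ ^ 2) ^ p) x =
      2 * p * (2 * p - 2 + d) * (‖x‖ ^ 2) ^ (p - 1) := by
  have hpos : 0 < ‖x‖ ^ 2 := by positivity
  have key (i : Fin d) : fderiv ℝ (fun y => fderiv ℝ
      (fun z : EuclideanSpace ℝ (Fin d) => (‖z‖ ^ 2) ^ p) y (EuclideanSpace.single i 1)) x
      (EuclideanSpace.single i 1) =
      4 * p * (p - 1) * (‖x‖ ^ 2) ^ (p - 2) * x i ^ 2 + 2 * p * (‖x‖ ^ 2) ^ (p - 1) := by
    have heq : (fun y => fderiv ℝ (fun z : EuclideanSpace ℝ (Fin d) => (‖z‖ ^ 2) ^ p) y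
        (EuclideanSpace.single i 1)) =ᶠ[nhds x]
        fun y => 2 * p * ((‖y‖ ^ 2) ^ (p - 1) * y i) := by
      filter_upwards [isOpen_ne.mem_nhds hx] with y hy
      rw [(hasFDerivAt_norm_sq_rpow p hy).fderiv]
      simp [EuclideanSpace.inner_single_right]
      ring
    have hproj : HasFDerivAt (fun y : EuclideanSpace ℝ (Fin d) => y i)
        (EuclideanSpace.proj i : EuclideanSpace ℝ (Fin d) →L[ℝ] ℝ) x :=
      (EuclideanSpace.proj i : EuclideanSpace ℝ (Fin d) →L[ℝ] ℝ).hasFDerivAt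
    have hprod : HasFDerivAt (fun y : EuclideanSpace ℝ (Fin d) =>
        2 * p * ((‖y‖ ^ 2) ^ (p - 1) * y i)) _ x :=
      ((hasFDerivAt_norm_sq_rpow (p - 1) hx).mul hproj).const_mul (2 * p)
    rw [heq.fderiv_eq, hprod.fderiv]
    simp [EuclideanSpace.inner_single_right]
    rw [show p - 1 - 1 = p - 2 by ring]
    ring
  simp only [lapl, key, Finset.sum_add_distrib, ← Finset.mul_sum]
  rw [← EuclideanSpace.real_norm_sq_eq, show p - 1 = p - 2 + 1 by ring, Real.rpow_add_one hpos.ne']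
  simp
  ring

lemma lapl_norm_sq {d : ℕ} (x : EuclideanSpace ℝ (Fin d)) :
    lapl d (fun y => ‖y‖ ^ 2) x = 2 * d := by
  have h (i : Fin d) : (fun y => fderiv ℝ (fun z : EuclideanSpace ℝ (Fin d) => ‖z‖ ^ 2) y
      (EuclideanSpace.single i 1)) = fun y => 2 * y i := by
    ext y
    rw [(hasStrictFDerivAt_norm_sq y).hasFDerivAt.fderiv]
    simp [EuclideanSpace.inner_single_right]
  have h' (i : Fin d) : HasFDerivAt (fun y : EuclideanSpace ℝ (Fin d) => 2 * y i)
      ((2 : ℝ) • (EuclideanSpace.proj i : EuclideanSpace ℝ (Fin d) →L[ℝ] ℝ)) x :=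
    (EuclideanSpace.proj i : EuclideanSpace ℝ (Fin d) →L[ℝ] ℝ).hasFDerivAt.const_mul 2
  simp only [lapl, h, fun i => (h' i).fderiv]
  simp [mul_comm]

/-- A weak maximum principle: a function on a compact set that is subharmonic on an open subset
and nonpositive on the rest is nonpositive. -/
lemma nonpos_of_lapl_nonneg {d : ℕ} (hd : 0 < d) {f : EuclideanSpace ℝ (Fin d) → ℝ}
    {K U : Set (EuclideanSpace ℝ (Fin d))} (hK : IsCompact K) (hU : IsOpen U) (hUK : U ⊆ K)
    (hf : ContinuousOn f K) (hbdry : ∀ x ∈ K \ U, f x ≤ 0)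
    (hsmooth : ∀ x ∈ U, ContDiffAt ℝ 2 f x) (hlapl : ∀ x ∈ U, 0 ≤ lapl d f x) :
    ∀ x ∈ K, f x ≤ 0 := by
  intro x hx
  obtain ⟨R, hR⟩ := hK.isBounded.exists_norm_le
  by_contra! hpos
  set ε : ℝ := f x / (R ^ 2 + 1)
  have hε : 0 < ε := by positivity
  have hεR : ε * R ^ 2 < f x := by
    have : ε * (R ^ 2 + 1) = f x := div_mul_cancel₀ _ (by positivity)
    linarith
  obtain ⟨z, hzK, hz⟩ := hK.exists_isMaxOn (f := fun y => f y + ε * ‖y‖ ^ 2) ⟨x, hx⟩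
    (by fun_prop)
  have hxz : f x + ε * ‖x‖ ^ 2 ≤ f z + ε * ‖z‖ ^ 2 := hz hx
  have hzR : ‖z‖ ^ 2 ≤ R ^ 2 := pow_le_pow_left₀ (norm_nonneg z) (hR z hzK) 2
  have hzU : z ∈ U := by
    by_contra hzU
    have h₁ := hbdry z ⟨hzK, hzU⟩
    have h₂ := mul_le_mul_of_nonneg_left hzR hε.le
    have h₃ : 0 ≤ ε * ‖x‖ ^ 2 := by positivity
    linarith
  have hsq : ContDiffAt ℝ 2 (fun y : EuclideanSpace ℝ (Fin d) => ε * ‖y‖ ^ 2) z :=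
    (contDiff_const.mul (contDiff_norm_sq ℝ)).contDiffAt
  have hle := lapl_nonpos_of_isLocalMax ((hsmooth z hzU).add hsq)
    (hz.isLocalMax (mem_of_superset (hU.mem_nhds hzU) hUK))
  have heq := lapl_add (hsmooth z hzU) hsq
  rw [lapl_const_mul, lapl_norm_sq] at heq
  have h₁ := hlapl z hzU
  have h₂ : 0 < ε * (2 * d) := by positivity
  change lapl d (fun y => f y + ε * ‖y‖ ^ 2) z ≤ 0 at hle
  linarith

lemma eventually_le_mul_norm_sq_rpow {d : ℕ} {v : EuclideanSpace ℝ (Fin d) → ℝ}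
    (hv : ContinuousAt v 0) {A p : ℝ} (hA : 0 < A) (hp : p < 0) :
    ∀ᶠ y in nhdsWithin 0 {0}ᶜ, v y ≤ A * (‖y‖ ^ 2) ^ p := by
  have hsq : Tendsto (fun y : EuclideanSpace ℝ (Fin d) => ‖y‖ ^ 2) (nhdsWithin 0 {0}ᶜ)
      (nhdsWithin 0 (Ioi 0)) := by
    refine tendsto_nhdsWithin_iff.2 ⟨?_, ?_⟩
    · have : Continuous fun y : EuclideanSpace ℝ (Fin d) => ‖y‖ ^ 2 := by fun_prop
      simpa using (this.tendsto 0).mono_left nhdsWithin_le_nhds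
    · filter_upwards [self_mem_nhdsWithin] with y hy
      have : y ≠ 0 := hy
      exact mem_Ioi.2 (by positivity)
  have hlim := ((tendsto_rpow_neg_nhdsGT_zero hp).comp hsq).const_mul_atTop hA
  filter_upwards [(hv.tendsto.mono_left nhdsWithin_le_nhds).eventually_lt_const (lt_add_one (v 0)),
    hlim.eventually_ge_atTop (v 0 + 1)] with y h₁ h₂
  exact h₁.le.trans h₂

/-- Comparison with the barrier `A |x|^{1-n} + t` for a decaying function that is harmonic
off a closed set on which it lies below the barrier. -/
lemma le_barrier_of_isHarmonicOnSet {n : ℕ} (hn : 2 ≤ n)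
    {v : EuclideanSpace ℝ (Fin (n + 1)) → ℝ} (hv : Continuous v)
    (hdecay : VanishAtInfty (n + 1) v) {Λ : Set (EuclideanSpace ℝ (Fin (n + 1)))}
    (hΛ : IsClosed Λ) (hharm : IsHarmonicOnSet (n + 1) v Λᶜ) {A t : ℝ} (hA : 0 < A) (ht : 0 ≤ t)
    (hle : ∀ x ∈ Λ, x ≠ 0 → v x ≤ A * (‖x‖ ^ 2) ^ ((1 - n : ℝ) / 2) + t)
    {x : EuclideanSpace ℝ (Fin (n + 1))} (hx : x ≠ 0) :
    v x ≤ A * (‖x‖ ^ 2) ^ ((1 - n : ℝ) / 2) + t := by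
  set p : ℝ := (1 - n : ℝ) / 2 with hpdef
  have hp : p < 0 := by
    have : (2 : ℝ) ≤ n := by exact_mod_cast hn
    linarith
  refine le_of_forall_pos_le_add fun ε hε => ?_
  obtain ⟨R₀, hR₀⟩ := hdecay ε hε
  obtain ⟨δ, hδ, hδv⟩ := Metric.mem_nhdsWithin_iff.1
    (eventually_le_mul_norm_sq_rpow hv.continuousAt hA hp)
  set R := max R₀ ‖x‖
  set r := min (δ / 2) ‖x‖
  have hxpos : 0 < ‖x‖ := norm_pos_iff.2 hx
  have hr : 0 < r := by positivity
  have hne {y : EuclideanSpace ℝ (Fin (n + 1))} (hy : r ≤ ‖y‖) : y ≠ 0 :=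
    norm_pos_iff.1 (hr.trans_le hy)
  have hsmooth {y : EuclideanSpace ℝ (Fin (n + 1))} (hy : y ≠ 0) :
      ContDiffAt ℝ 2 (fun y => -A * (‖y‖ ^ 2) ^ p) y :=
    contDiffAt_const.mul (contDiffAt_norm_sq_rpow p hy)
  have hvsmooth {y : EuclideanSpace ℝ (Fin (n + 1))} (hy : y ∈ Λᶜ) : ContDiffAt ℝ 2 v y :=
    hharm.1.contDiffAt (hΛ.isOpen_compl.mem_nhds hy)
  have hconst {y : EuclideanSpace ℝ (Fin (n + 1))} :
      ContDiffAt ℝ 2 (fun _ : EuclideanSpace ℝ (Fin (n + 1)) => -(t + ε)) y := contDiffAt_const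
  have key := nonpos_of_lapl_nonneg (Nat.succ_pos n)
    (f := fun y => v y + (-A * (‖y‖ ^ 2) ^ p + -(t + ε)))
    (K := closedBall 0 R \ ball 0 r) (U := (ball 0 R \ closedBall 0 r) ∩ Λᶜ)
    ((isCompact_closedBall 0 R).diff isOpen_ball)
    ((isOpen_ball.sdiff isClosed_closedBall).inter hΛ.isOpen_compl)
    (inter_subset_left.trans (sdiff_subset_sdiff ball_subset_closedBall ball_subset_closedBall))
    ?_ ?_ ?_ ?_ x (by simp [R, r])
  · linarith
  · intro y hy
    have hy' : y ≠ 0 := hne (by simpa using hy.2)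
    exact (hv.continuousAt.add
      ((hsmooth hy').continuousAt.add continuousAt_const)).continuousWithinAt
  · rintro y ⟨⟨-, hyr⟩, hyU⟩
    have hyr' : r ≤ ‖y‖ := by simpa using hyr
    have hnonneg : 0 ≤ A * (‖y‖ ^ 2) ^ p := by positivity
    have hbound : v y ≤ A * (‖y‖ ^ 2) ^ p + t + ε := by
      by_cases hyΛ : y ∈ Λ
      · linarith [hle y hyΛ (hne hyr')]
      · by_cases hyR : ‖y‖ < R
        · have hyeq : ‖y‖ ≤ r := by
            by_contra! hlt
            exact hyU ⟨⟨by simpa using hyR, by simpa using hlt⟩, hyΛ⟩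
          have hyδ : y ∈ ball (0 : EuclideanSpace ℝ (Fin (n + 1))) δ := by
            have : r ≤ δ / 2 := min_le_left _ _
            simp only [mem_ball_zero_iff]
            linarith
          have : v y ≤ A * (‖y‖ ^ 2) ^ p := hδv ⟨hyδ, hne hyr'⟩
          linarith
        · have := (abs_lt.1 (hR₀ y ((le_max_left _ _).trans (not_lt.1 hyR)))).2
          linarith
    change v y + (-A * (‖y‖ ^ 2) ^ p + -(t + ε)) ≤ 0
    linarith
  · rintro y ⟨⟨-, hyr⟩, hyΛ⟩
    have hy : y ≠ 0 := hne (not_le.1 (by simpa using hyr)).le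
    exact (hvsmooth hyΛ).add ((hsmooth hy).add hconst)
  · rintro y ⟨⟨-, hyr⟩, hyΛ⟩
    have hy : y ≠ 0 := hne (not_le.1 (by simpa using hyr)).le
    rw [lapl_add (hvsmooth hyΛ) ((hsmooth hy).add hconst), lapl_add (hsmooth hy) hconst,
      lapl_const_mul, lapl_norm_sq_rpow p hy, lapl_const, hharm.2 y hyΛ]
    have hzero : 2 * p - 2 + ((n.succ : ℕ) : ℝ) = 0 := by
      push_cast
      rw [hpdef]
      ring
    rw [hzero]
    simp

/-- The minimum principle for decaying continuous functions with the super-mean-value property. -/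
lemma SuperMeanVal.nonneg {d : ℕ} (hd : 0 < d) {v : EuclideanSpace ℝ (Fin d) → ℝ}
    (hmean : SuperMeanVal d v) (hv : Continuous v) (hdecay : VanishAtInfty d v)
    (x : EuclideanSpace ℝ (Fin d)) : 0 ≤ v x := by
  by_contra! hx
  have : Nonempty (Fin d) := ⟨⟨0, hd⟩⟩
  obtain ⟨R, hR⟩ := hdecay (-v x) (neg_pos.2 hx)
  have hlarge {y : EuclideanSpace ℝ (Fin d)} (hy : R ≤ ‖y‖) : v x < v y := by
    linarith [(abs_lt.1 (hR y hy)).1]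
  have hxR : ‖x‖ < R := by
    by_contra! h
    exact lt_irrefl _ (hlarge h)
  obtain ⟨z, -, hz⟩ := (isCompact_closedBall (0 : EuclideanSpace ℝ (Fin d)) R).exists_isMinOn
    ⟨x, by simpa using hxR.le⟩ hv.continuousOn
  have hmin (y : EuclideanSpace ℝ (Fin d)) : v z ≤ v y := by
    rcases le_total ‖y‖ R with hy | hy
    · exact hz (by simpa using hy)
    · exact (hz (by simpa using hxR.le : x ∈ closedBall 0 R)).trans (hlarge hy).le
  obtain ⟨y, hy⟩ := NormedSpace.exists_lt_norm ℝ (EuclideanSpace ℝ (Fin d)) R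
  set r := dist y z + 1
  have hr : 0 < r := by positivity
  have hint (g : EuclideanSpace ℝ (Fin d) → ℝ) (hg : Continuous g) :
      IntegrableOn g (ball z r) :=
    (hg.continuousOn.integrableOn_compact (isCompact_closedBall z r)).mono_set
      ball_subset_closedBall
  have hvol : 0 < volume.real (ball z r) :=
    ENNReal.toReal_pos (measure_ball_pos volume z hr).ne' measure_ball_lt_top.ne
  have havg := hmean z r hr
  rw [setAverage_eq, smul_eq_mul, inv_mul_le_iff₀ hvol] at havg
  have hsub : ∫ w in ball z r, (v w - v z) = 0 := by
    refine le_antisymm ?_ (integral_nonneg fun w => sub_nonneg.2 (hmin w))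
    rw [integral_sub (hint v hv) (hint _ continuous_const), setIntegral_const, smul_eq_mul]
    linarith
  rw [setIntegral_eq_zero_iff_of_nonneg_ae (ae_of_all _ fun w => sub_nonneg.2 (hmin w))
    (hint _ (hv.sub continuous_const))] at hsub
  have heq := Measure.eqOn_open_of_ae_eq hsub isOpen_ball
    (hv.sub continuous_const).continuousOn continuousOn_const
    (by simp [r] : y ∈ ball z r)
  have : v y - v z = 0 := heq
  linarith [hlarge hy.le, hmin x]

@[simp]
lemma thinEmbed_last (n : ℕ) (x' : EuclideanSpace ℝ (Fin n)) (t : ℝ) :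
    thinEmbed n x' t (Fin.last n) = t := by
  simp [thinEmbed]

@[simp]
lemma thinProj_thinEmbed (n : ℕ) (x' : EuclideanSpace ℝ (Fin n)) (t : ℝ) :
    thinProj n (thinEmbed n x' t) = x' := by
  ext i
  simp [thinProj, thinEmbed]

lemma norm_thinProj {n : ℕ} {x : EuclideanSpace ℝ (Fin (n + 1))} (hx : x (Fin.last n) = 0) :
    ‖thinProj n x‖ = ‖x‖ := by
  simp [EuclideanSpace.norm_eq, Fin.sum_univ_castSucc, hx, thinProj]

lemma norm_thinEmbed_zero {n : ℕ} (x' : EuclideanSpace ℝ (Fin n)) :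
    ‖thinEmbed n x' 0‖ = ‖x'‖ := by
  rw [← norm_thinProj (thinEmbed_last n x' 0), thinProj_thinEmbed]

lemma continuous_thinEmbed (n : ℕ) (t : ℝ) : Continuous fun x' => thinEmbed n x' t := by
  refine (EuclideanSpace.equiv (Fin (n + 1)) ℝ).symm.continuous.comp
    (continuous_pi fun i => ?_)
  refine Fin.lastCases ?_ (fun j => ?_) i
  · simpa using continuous_const
  · simpa using (EuclideanSpace.proj j : EuclideanSpace ℝ (Fin n) →L[ℝ] ℝ).continuous

lemma continuous_thinProj (n : ℕ) : Continuous (thinProj n) :=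
  (EuclideanSpace.equiv (Fin n) ℝ).symm.continuous.comp
    (continuous_pi fun i =>
      (EuclideanSpace.proj i.castSucc : EuclideanSpace ℝ (Fin (n + 1)) →L[ℝ] ℝ).continuous)

lemma isClosed_contactSet {n : ℕ} {φ : EuclideanSpace ℝ (Fin n) → ℝ}
    {u : EuclideanSpace ℝ (Fin (n + 1)) → ℝ} (hφ : Continuous φ) (hu : Continuous u) :
    IsClosed (contactSet n φ u) :=
  (isClosed_eq (EuclideanSpace.proj (Fin.last n) :
      EuclideanSpace ℝ (Fin (n + 1)) →L[ℝ] ℝ).continuous continuous_const).inter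
    (isClosed_eq hu (hφ.comp (continuous_thinProj n)))

lemma rhoBar_eq {k n : ℕ} (hn : 2 ≤ n) (hk : 1 ≤ k) :
    rhoBar k n = (1 + (k : ℝ) / ((n : ℝ) - 1)) ^ (-(1 : ℝ) / k) := by
  have hm : (0 : ℝ) < (n : ℝ) - 1 := by
    have : (2 : ℝ) ≤ n := by exact_mod_cast hn
    linarith
  have hk' : (0 : ℝ) < k := by exact_mod_cast hk
  unfold rhoBar
  rw [mul_div_cancel₀ (k : ℝ) hm.ne']
  have hkm : (k : ℝ) = (k / ((n : ℝ) - 1)) * (n - 1) := (div_mul_cancel₀ _ hm.ne').symm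
  set κ := (k : ℝ) / ((n : ℝ) - 1) with hκdef
  have hκ : 0 < κ := by positivity
  have hsum : κ ^ (-κ / (κ + 1)) + κ ^ ((1 : ℝ) / (κ + 1)) = κ ^ (-κ / (κ + 1)) * (1 + κ) := by
    rw [show (1 : ℝ) / (κ + 1) = -κ / (κ + 1) + 1 by field_simp; ring, Real.rpow_add_one hκ.ne']
    ring
  rw [hsum, Real.mul_rpow (by positivity) (by positivity), ← Real.rpow_mul hκ.le, ← mul_assoc,
    ← Real.rpow_add hκ]
  have : -1 / ((↑n - 1) * (κ + 1)) + -κ / (κ + 1) * (-1 / (k : ℝ)) = 0 := by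
    rw [hkm]
    field_simp
    ring
  rw [this, Real.rpow_zero, one_mul]

lemma tendsto_rhoBar {n : ℕ} (hn : 2 ≤ n) :
    Tendsto (fun j : ℕ => rhoBar j n) atTop (nhds 1) := by
  have hm : (0 : ℝ) < (n : ℝ) - 1 := by
    have : (2 : ℝ) ≤ n := by exact_mod_cast hn
    linarith
  have hbase : Tendsto (fun j : ℕ => 1 + (j : ℝ) / ((n : ℝ) - 1)) atTop atTop :=
    tendsto_atTop_add_const_left _ _ (tendsto_natCast_atTop_atTop.atTop_div_const hm)
  refine ((tendsto_rpow_div_mul_add (-1) ((n : ℝ) - 1) (-((n : ℝ) - 1)) hm.ne).comp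
    hbase).congr' ?_
  filter_upwards [eventually_ge_atTop 1] with j hj
  rw [rhoBar_eq hn hj, Function.comp_apply]
  congr 2
  field_simp
  ring

lemma one_add_mul_pow_le_one {k n : ℕ} (hn : 2 ≤ n) (hk : 1 ≤ k) {ρ : ℝ} (hρ : 0 ≤ ρ)
    (hle : ρ ≤ rhoBar k n) : (1 + (k : ℝ) / ((n : ℝ) - 1)) * ρ ^ k ≤ 1 := by
  have hm : (0 : ℝ) < (n : ℝ) - 1 := by
    have : (2 : ℝ) ≤ n := by exact_mod_cast hn
    linarith
  have hk' : (k : ℝ) ≠ 0 := by exact_mod_cast (by lia : k ≠ 0)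
  have hpos : 0 < 1 + (k : ℝ) / ((n : ℝ) - 1) := by positivity
  have hpow := pow_le_pow_left₀ hρ hle k
  rw [rhoBar_eq hn hk, ← Real.rpow_natCast (_ ^ _), ← Real.rpow_mul hpos.le,
    div_mul_cancel₀ _ hk', Real.rpow_neg_one] at hpow
  rwa [← le_div_iff₀' hpos, one_div]

/-- The weighted arithmetic–geometric mean inequality in homogeneous polynomial form. -/
lemma add_mul_pow_mul_pow_le {k m : ℕ} (hm : 0 < m) {a b : ℝ} (ha : 0 ≤ a) (hb : 0 ≤ b) :
    ((k : ℝ) + m) * (a ^ k * b ^ m) ≤ k * a ^ (k + m) + m * b ^ (k + m) := by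
  have hm' : (0 : ℝ) < m := by exact_mod_cast hm
  have hkm : (0 : ℝ) < (k : ℝ) + m := by positivity
  have hroot (c : ℝ) (hc : 0 ≤ c) (j : ℕ) :
      (c ^ (k + m)) ^ ((j : ℝ) / (k + m)) = c ^ j := by
    rw [← Real.rpow_natCast, ← Real.rpow_mul hc, ← Real.rpow_natCast c j]
    congr 1
    push_cast
    field_simp
  have h := Real.geom_mean_le_arith_mean2_weighted (w₁ := k / (k + m)) (w₂ := m / (k + m))
    (p₁ := a ^ (k + m)) (p₂ := b ^ (k + m)) (by positivity) (by positivity) (by positivity)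
    (by positivity) (by field_simp)
  rw [hroot a ha, hroot b hb] at h
  calc ((k : ℝ) + m) * (a ^ k * b ^ m)
      ≤ (k + m) * (k / (k + m) * a ^ (k + m) + m / (k + m) * b ^ (k + m)) := by gcongr
    _ = k * a ^ (k + m) + m * b ^ (k + m) := by field_simp

lemma sq_rpow_one_sub_div_two {n : ℕ} (hn : 1 ≤ n) {r : ℝ} (hr : 0 ≤ r) :
    (r ^ 2) ^ ((1 - n : ℝ) / 2) = (r ^ (n - 1))⁻¹ := by
  rw [← Real.rpow_natCast r 2, ← Real.rpow_mul hr, ← Real.rpow_natCast, ← Real.rpow_neg hr,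
    Nat.cast_sub hn]
  congr 1
  push_cast
  ring

/-- The barrier touching `1 - r ^ k` at `r = ρ` lies above it. -/
lemma one_sub_pow_le_barrier {n k : ℕ} (hn : 2 ≤ n) {ρ r : ℝ} (hρ : 0 ≤ ρ) (hr : 0 < r) :
    1 - r ^ k ≤ (k : ℝ) / ((n : ℝ) - 1) * ρ ^ (k + (n - 1)) * (r ^ 2) ^ ((1 - n : ℝ) / 2) +
      (1 - (1 + (k : ℝ) / ((n : ℝ) - 1)) * ρ ^ k) := by
  have hm : (0 : ℝ) < (n : ℝ) - 1 := by
    have : (2 : ℝ) ≤ n := by exact_mod_cast hn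
    linarith
  have h := add_mul_pow_mul_pow_le (k := k) (m := n - 1) (by lia) hρ hr.le
  rw [Nat.cast_sub (by lia : 1 ≤ n), Nat.cast_one] at h
  rw [sq_rpow_one_sub_div_two (by lia) hr.le]
  have hdiff : (k : ℝ) / ((n : ℝ) - 1) * ρ ^ (k + (n - 1)) * (r ^ (n - 1))⁻¹ +
      (1 - (1 + (k : ℝ) / ((n : ℝ) - 1)) * ρ ^ k) - (1 - r ^ k) =
      (k * ρ ^ (k + (n - 1)) + ((n : ℝ) - 1) * r ^ (k + (n - 1)) -
        (k + ((n : ℝ) - 1)) * (ρ ^ k * r ^ (n - 1))) / (((n : ℝ) - 1) * r ^ (n - 1)) := by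
    rw [pow_add r]
    field_simp
    ring
  have hnonneg := div_nonneg (sub_nonneg.2 h) (by positivity : 0 ≤ ((n : ℝ) - 1) * r ^ (n - 1))
  linarith

lemma barrier_self {n k : ℕ} (hn : 1 ≤ n) {κ ρ : ℝ} (hρ : 0 < ρ) :
    κ * ρ ^ (k + (n - 1)) * (ρ ^ 2) ^ ((1 - n : ℝ) / 2) + (1 - (1 + κ) * ρ ^ k) = 1 - ρ ^ k := by
  rw [sq_rpow_one_sub_div_two hn hρ.le, pow_add]
  field_simp
  ring

/-- for the thin obstacle `1 - |x'|^k`, the coincidence set on the thin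
space contains the ball of radius `ρ̄(k,n)` and is contained in the unit ball;
moreover `c_{n,k} = 1 - ρ̄(k,n) → 0` as `k → ∞`. -/
theorem statement9 (n k : ℕ) (hn : 2 ≤ n) (hk : 2 ≤ k)
    (v : EuclideanSpace ℝ (Fin (n + 1)) → ℝ)
    (hv : IsGlobalSolution n (fun x' => 1 - ‖x'‖ ^ k) v)
    (hdecay : VanishAtInfty (n + 1) v) :
    {x' : EuclideanSpace ℝ (Fin n) | ‖x'‖ ≤ rhoBar k n} ⊆
      {x' : EuclideanSpace ℝ (Fin n) | v (thinEmbed n x' 0) = 1 - ‖x'‖ ^ k} ∧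
    {x' : EuclideanSpace ℝ (Fin n) | v (thinEmbed n x' 0) = 1 - ‖x'‖ ^ k} ⊆
      {x' : EuclideanSpace ℝ (Fin n) | ‖x'‖ ≤ 1} ∧
    Filter.Tendsto (fun j : ℕ => 1 - rhoBar j n) Filter.atTop (nhds 0) := by
  obtain ⟨hcont, -, hobs, hharm, hmean⟩ := hv
  have hm : (0 : ℝ) < (n : ℝ) - 1 := by
    have : (2 : ℝ) ≤ n := by exact_mod_cast hn
    linarith
  have hk' : (0 : ℝ) < k := by exact_mod_cast (by lia : 0 < k)
  have hφ : Continuous fun x' : EuclideanSpace ℝ (Fin n) => 1 - ‖x'‖ ^ k := by fun_prop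
  have hpunctured (x' : EuclideanSpace ℝ (Fin n)) (hx' : ‖x'‖ ≤ rhoBar k n) (hne : x' ≠ 0) :
      v (thinEmbed n x' 0) = 1 - ‖x'‖ ^ k := by
    refine le_antisymm ?_ (hobs x')
    have hpos : 0 < ‖x'‖ := norm_pos_iff.2 hne
    have hle := le_barrier_of_isHarmonicOnSet hn hcont hdecay (isClosed_contactSet hφ hcont) hharm
      (A := (k : ℝ) / ((n : ℝ) - 1) * ‖x'‖ ^ (k + (n - 1)))
      (t := 1 - (1 + (k : ℝ) / ((n : ℝ) - 1)) * ‖x'‖ ^ k) (by positivity)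
      (sub_nonneg.2 (one_add_mul_pow_le_one hn (by lia) hpos.le hx'))
      (fun y hy hy₀ => by
        rw [hy.2, ← norm_thinProj hy.1]
        exact one_sub_pow_le_barrier hn hpos.le
          ((norm_thinProj hy.1).symm ▸ norm_pos_iff.2 hy₀))
      (x := thinEmbed n x' 0) (norm_pos_iff.1 (by rwa [norm_thinEmbed_zero]))
    rwa [norm_thinEmbed_zero, barrier_self (by lia) hpos] at hle
  refine ⟨fun x' hx' => ?_, fun x' hx' => ?_, ?_⟩
  · by_cases hne : x' = 0
    · subst hne
      have : Nonempty (Fin n) := ⟨⟨0, by lia⟩⟩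
      have hρ : 0 < rhoBar k n := by
        rw [rhoBar_eq hn (by lia)]
        positivity
      have heq : (fun y => v (thinEmbed n y 0)) =ᶠ[nhdsWithin 0 {0}ᶜ]
          fun y : EuclideanSpace ℝ (Fin n) => 1 - ‖y‖ ^ k := by
        filter_upwards [self_mem_nhdsWithin, nhdsWithin_le_nhds (ball_mem_nhds 0 hρ)] with y h₁ h₂
        exact hpunctured y (mem_ball_zero_iff.1 h₂).le h₁
      have hcont' := (hcont.comp (continuous_thinEmbed n 0)).continuousAt (x := 0)
      exact ((hcont'.eventuallyEq_nhds_iff_eventuallyEq_nhdsNE hφ.continuousAt).1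
        heq).self_of_nhds
    · exact hpunctured x' hx' hne
  · have hnonneg := hmean.nonneg (Nat.succ_pos n) hcont hdecay (thinEmbed n x' 0)
    have hx'' : v (thinEmbed n x' 0) = 1 - ‖x'‖ ^ k := hx'
    rw [hx'', sub_nonneg] at hnonneg
    exact (pow_le_one_iff_of_nonneg (norm_nonneg x') (by lia)).1 hnonneg
  · simpa using (tendsto_rhoBar hn).const_sub 1

end
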